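/- Let 1 ≤ m ≤ d be integers and let a_1, …, a_m be pairwise distinct nonzero real numbers. Then Z_d(a_1, …, a_m) / Z_d = [∏_{1≤j<k≤m} (a_j − a_k)]^{−1} · det[ a_k^{m−j} · Z_{d+1−j}(a_k) / Z_{d+1−j} ]_{j,k=1}^{m}, where each Z_{d+1−j} and Z_d is nonzero because W is nonnegative with infinite support. -/

import Mathlib

open MeasureTheory
open scoped BigOperators

/-- The Vandermonde product `Δ(λ) = ∏_{i<j} (λ_j − λ_i)`. -/
def vandermondeProd {d : ℕ} (l : Fin d → ℝ) : ℝ :=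
  ∏ p ∈ Finset.univ.filter (fun p : Fin d × Fin d => p.1 < p.2), (l p.2 - l p.1)

/-- The pairs `(j,k)` with `0 ≤ j < k < m`. -/
def pairsBelow (m : ℕ) : Finset (ℕ × ℕ) :=
  (Finset.range m ×ˢ Finset.range m).filter (fun p => p.1 < p.2)

/-- The normalized partition function `Z_d(a_0,…,a_{m−1})` of the Hermitian matrix model
with external source eigenvalues `(a_0,…,a_{m−1},0,…,0)` and weight `W`:
`Z_d(a) = [∏_{i=0}^{d−m−1} i! · ∏_{j<k<m} (a_k − a_j) · ∏_{k<m} a_k^{d−m}]⁻¹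
  ∫_{ℝ^d} det B(λ) Δ(λ) ∏ W(λ_i) dλ`,
where `B(λ)_{i,k} = λ_k^i` for `i < d−m` and `B(λ)_{i,k} = e^{a_{i−(d−m)} λ_k}` otherwise.
For `m = 0` this is `Z_d = [∏_{i<d} i!]⁻¹ ∫ Δ(λ)² ∏ W(λ_i) dλ`. -/
noncomputable def Zpart (W : ℝ → ℝ) (d m : ℕ) (a : ℕ → ℝ) : ℝ :=
  ((∏ i ∈ Finset.range (d - m), (Nat.factorial i : ℝ)) *
      (∏ p ∈ pairsBelow m, (a p.2 - a p.1)) *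
      ∏ k ∈ Finset.range m, a k ^ (d - m))⁻¹ *
    ∫ l : Fin d → ℝ,
      (Matrix.of fun i k : Fin d =>
          if (i : ℕ) < d - m then l k ^ (i : ℕ)
          else Real.exp (a ((i : ℕ) - (d - m)) * l k)).det *
        vandermondeProd l * ∏ i : Fin d, W (l i)

/-- The exponential moment `∫ x^n e^{bx} W(x) dx`. -/
noncomputable def expMoment (W : ℝ → ℝ) (b : ℝ) (n : ℕ) : ℝ :=
  ∫ x, x ^ n * Real.exp (b * x) * W x

/-- The pairing of a row `f` with the `k`-th polynomial, whose coefficients are `c k 0, …, c k k`. -/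
def rowPair (c : ℕ → ℕ → ℝ) (f : ℕ → ℝ) (k : ℕ) : ℝ :=
  ∑ l ∈ Finset.range (k + 1), f l * c k l

lemma prod_pairsBelow (m : ℕ) (f : ℕ → ℕ → ℝ) :
    ∏ p ∈ pairsBelow m, f p.1 p.2 = ∏ i : Fin m, ∏ j ∈ Finset.Ioi i, f i j := by
  have h (i : Fin m) : Finset.Ioi i = Finset.univ.filter (fun j => i < j) := by
    ext j; simp
  simp only [pairsBelow, h]
  rw [Finset.prod_filter, Finset.prod_product, Finset.prod_range]
  refine Finset.prod_congr rfl fun i _ => ?_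
  rw [Finset.prod_range, Finset.prod_filter]
  rfl

lemma vandermondeProd_eq_det {d : ℕ} (l : Fin d → ℝ) :
    vandermondeProd l = (Matrix.vandermonde l).det := by
  have h (i : Fin d) : Finset.Ioi i = Finset.univ.filter (fun j => i < j) := by
    ext j; simp
  rw [Matrix.det_vandermonde, vandermondeProd, Finset.prod_filter, ← Finset.univ_product_univ,
    Finset.prod_product]
  exact Finset.prod_congr rfl fun i _ => by rw [h, Finset.prod_filter]

/-- Reversing the rows of a matrix produces the same sign as reversing a Vandermonde product. -/
lemma inv_prod_pairsBelow_mul_det (m : ℕ) (a : ℕ → ℝ) (N : Matrix (Fin m) (Fin m) ℝ) :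
    (∏ p ∈ pairsBelow m, (a p.1 - a p.2))⁻¹ * (N.submatrix Fin.revPerm id).det =
      (∏ p ∈ pairsBelow m, (a p.2 - a p.1))⁻¹ * N.det := by
  have h1 : ∏ p ∈ pairsBelow m, (a p.1 - a p.2) =
      (Equiv.Perm.sign (Fin.revPerm (n := m)) : ℤ) * ∏ p ∈ pairsBelow m, (a p.2 - a p.1) := by
    rw [prod_pairsBelow m (fun i j => a i - a j), prod_pairsBelow m (fun i j => a j - a i)]
    have hv := Matrix.det_vandermonde (fun i : Fin m => a i)
    have hp := Matrix.det_projVandermonde 1 (fun i : Fin m => a i)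
    have : Matrix.projVandermonde 1 (fun i : Fin m => a i) =
        (Matrix.vandermonde (fun i : Fin m => a i)).submatrix id Fin.revPerm := by
      ext i j
      simp [Matrix.projVandermonde_apply, Matrix.vandermonde_apply]
    rw [this, Matrix.det_permute', hv] at hp
    simpa using hp.symm
  rw [h1, Matrix.det_permute]
  rcases Int.units_eq_one_or (Equiv.Perm.sign (Fin.revPerm (n := m))) with h | h <;> simp [h]

section LinearAlgebra

lemma det_bordered (s m : ℕ) (H c : ℕ → ℕ → ℝ) (F : Fin m → ℕ → ℝ)
    (hc : ∀ k, c k k = 1) (horth : ∀ k, ∀ i < k, rowPair c (H i) k = 0) :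
    (Matrix.of fun i k : Fin (s + m) => Fin.addCases (fun i' : Fin s => H i' k)
        (fun j => F j k) i).det =
      (∏ i ∈ Finset.range s, rowPair c (H i) i) *
        (Matrix.of fun j k : Fin m => rowPair c (F j) (s + k)).det := by
  set C : Matrix (Fin (s + m)) (Fin (s + m)) ℝ :=
    Matrix.of fun l k => if l ≤ k then c k l else 0 with hC
  have hCdet : C.det = 1 := by
    rw [Matrix.det_of_isUpperTriangular]
    · simp [hC, hc]
    · intro i j hij
      have : ¬ i ≤ j := not_le.mpr hij
      simp [hC, this]
  have hsum (f : ℕ → ℝ) (k : Fin (s + m)) :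
      ∑ l : Fin (s + m), f l * C l k = rowPair c f k := by
    have hr : rowPair c f k =
        ∑ l ∈ Finset.range (s + m), if l ≤ (k : ℕ) then f l * c k l else 0 := by
      rw [rowPair, ← Finset.sum_filter]
      congr 1
      ext l
      have := k.isLt
      simp only [Finset.mem_range, Finset.mem_filter]
      omega
    rw [hr, Finset.sum_range]
    exact Finset.sum_congr rfl fun l _ => by
      simp only [hC, Matrix.of_apply, Fin.le_def, mul_ite, mul_zero]
  set M : Matrix (Fin (s + m)) (Fin (s + m)) ℝ :=
    Matrix.of fun i k => Fin.addCases (fun i' : Fin s => H i' k) (fun j => F j k) i with hM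
  set A : Matrix (Fin s) (Fin s) ℝ := Matrix.of fun i k => rowPair c (H i) k with hA
  set B : Matrix (Fin m) (Fin s) ℝ := Matrix.of fun j k => rowPair c (F j) k with hB
  have hMC : (M * C).submatrix finSumFinEquiv finSumFinEquiv = Matrix.fromBlocks A 0 B
      (Matrix.of fun j k : Fin m => rowPair c (F j) (s + k)) := by
    ext i k
    rw [Matrix.submatrix_apply, Matrix.mul_apply]
    rcases i with i | j
    · have hrow (l : Fin (s + m)) : M (finSumFinEquiv (Sum.inl i)) l = H i l := by
        simp [hM]
      simp_rw [hrow, hsum]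
      rcases k with k | k
      · simp [hA]
      · simpa using horth (s + k) i (by omega)
    · have hrow (l : Fin (s + m)) : M (finSumFinEquiv (Sum.inr j)) l = F j l := by
        simp [hM]
      simp_rw [hrow, hsum]
      rcases k with k | k <;> simp [hB]
  have hAdet : A.det = ∏ i ∈ Finset.range s, rowPair c (H i) i := by
    rw [Matrix.det_of_isLowerTriangular A, Finset.prod_range]
    · rfl
    · intro i k hik
      exact horth k i hik
  rw [← hAdet, ← Matrix.det_fromBlocks_zero₁₂ A B, ← hMC, Matrix.det_submatrix_equiv_self,
    Matrix.det_mul, hCdet, mul_one]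

lemma exists_orthogonal_coeffs (H : ℕ → ℕ → ℝ)
    (hH : ∀ n, (Matrix.of fun i k : Fin n => H i k).det ≠ 0) :
    ∃ c : ℕ → ℕ → ℝ, (∀ k, c k k = 1) ∧ ∀ k, ∀ i < k, rowPair c (H i) k = 0 := by
  have key (k : ℕ) : ∃ x : ℕ → ℝ, x k = 1 ∧
      ∀ i < k, ∑ l ∈ Finset.range (k + 1), H i l * x l = 0 := by
    set A : Matrix (Fin k) (Fin k) ℝ := Matrix.of fun i k : Fin k => H i k with hA
    set x := A⁻¹.mulVec (fun i : Fin k => -H i k) with hx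
    have hAx : A.mulVec x = fun i : Fin k => -H i k := by
      rw [hx, Matrix.mulVec_mulVec, Matrix.mul_nonsing_inv _ (isUnit_iff_ne_zero.mpr (hH k)),
        Matrix.one_mulVec]
    refine ⟨fun l => if h : l < k then x ⟨l, h⟩ else 1, by simp, fun i hi => ?_⟩
    have := congrFun hAx ⟨i, hi⟩
    simp only [Matrix.mulVec, dotProduct, hA, Matrix.of_apply] at this
    rw [Finset.sum_range_succ, Finset.sum_range]
    simp [this]
  choose c hc using key
  exact ⟨c, fun k => (hc k).1, fun k => (hc k).2⟩

end LinearAlgebra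

section Andreief

lemma integrable_pow_mul_exp_mul {W : ℝ → ℝ} (hWmeas : Measurable W)
    (hWint : ∀ (n : ℕ) (b : ℝ), Integrable (fun x => |x| ^ n * Real.exp (b * x) * W x))
    (n : ℕ) (b : ℝ) : Integrable (fun x => x ^ n * Real.exp (b * x) * W x) := by
  refine (hWint n b).mono (by fun_prop) (Filter.Eventually.of_forall fun x => ?_)
  simp

/-- Andréief's integration formula against the Vandermonde determinant. -/
lemma integral_det_mul_vandermondeProd (W : ℝ → ℝ) (n : ℕ) (φ : Fin n → ℝ → ℝ)
    (hφ : ∀ i (k : Fin n), Integrable (fun x => φ i x * x ^ (k : ℕ) * W x)) :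
    ∫ l : Fin n → ℝ, (Matrix.of fun i k : Fin n => φ i (l k)).det * vandermondeProd l *
        ∏ i : Fin n, W (l i) =
      n.factorial * (Matrix.of fun i k : Fin n => ∫ x, φ i x * x ^ (k : ℕ) * W x).det := by
  set M : Matrix (Fin n) (Fin n) ℝ :=
    Matrix.of fun i k : Fin n => ∫ x, φ i x * x ^ (k : ℕ) * W x with hM
  have hexp (l : Fin n → ℝ) : (Matrix.of fun i k : Fin n => φ i (l k)).det * vandermondeProd l *
        ∏ i : Fin n, W (l i) = ∑ τ : Equiv.Perm (Fin n), ∑ σ : Equiv.Perm (Fin n),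
        ((Equiv.Perm.sign τ : ℤ) : ℝ) * ((Equiv.Perm.sign σ : ℤ) : ℝ) *
          ∏ k, (φ (σ k) (l k) * l k ^ (τ k : ℕ) * W (l k)) := by
    rw [vandermondeProd_eq_det, ← Matrix.det_transpose (Matrix.vandermonde l), Matrix.det_apply',
      Matrix.det_apply', Finset.sum_mul_sum, Finset.sum_comm, Finset.sum_mul]
    refine Finset.sum_congr rfl fun τ _ => ?_
    rw [Finset.sum_mul]
    refine Finset.sum_congr rfl fun σ _ => ?_
    simp only [Matrix.of_apply, Matrix.transpose_apply, Matrix.vandermonde_apply,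
      Finset.prod_mul_distrib]
    ring
  have hint (σ τ : Equiv.Perm (Fin n)) : Integrable (fun l : Fin n → ℝ =>
      ∏ k, (φ (σ k) (l k) * l k ^ (τ k : ℕ) * W (l k))) :=
    Integrable.fintype_prod (f := fun k x => φ (σ k) x * x ^ (τ k : ℕ) * W x)
      (fun k => hφ (σ k) (τ k))
  simp_rw [hexp]
  rw [integral_finsetSum _ fun τ _ => integrable_finsetSum _ fun σ _ =>
    (hint σ τ).const_mul _]
  have hτ (τ : Equiv.Perm (Fin n)) : ∫ l : Fin n → ℝ, ∑ σ : Equiv.Perm (Fin n),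
        ((Equiv.Perm.sign τ : ℤ) : ℝ) * ((Equiv.Perm.sign σ : ℤ) : ℝ) *
          ∏ k, (φ (σ k) (l k) * l k ^ (τ k : ℕ) * W (l k)) = M.det := by
    rw [integral_finsetSum _ fun σ _ => (hint σ τ).const_mul _]
    have h1 : ((Equiv.Perm.sign τ : ℤ) : ℝ) * (M.submatrix id τ).det = M.det := by
      rw [Matrix.det_permute', ← mul_assoc]
      rcases Int.units_eq_one_or (Equiv.Perm.sign τ) with h | h <;> simp [h]
    rw [← h1, Matrix.det_apply', Finset.mul_sum]
    refine Finset.sum_congr rfl fun σ _ => ?_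
    rw [integral_const_mul,
      integral_fintype_prod_volume_eq_prod (fun k x => φ (σ k) x * x ^ (τ k : ℕ) * W x), mul_assoc]
    rfl
  simp_rw [hτ]
  simp [Fintype.card_perm]

end Andreief

section Positivity

lemma det_hankel_ne_zero {W : ℝ → ℝ} (hWmeas : Measurable W) (hWnonneg : ∀ x, 0 ≤ W x)
    (hWint : ∀ (n : ℕ) (b : ℝ), Integrable (fun x => |x| ^ n * Real.exp (b * x) * W x))
    (hW : ¬ W =ᵐ[volume] 0) (n : ℕ) :
    (Matrix.of fun i k : Fin n => expMoment W 0 (i + k)).det ≠ 0 := by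
  intro hdet
  obtain ⟨v, hv0, hv⟩ := Matrix.exists_mulVec_eq_zero_iff.mpr hdet
  set p : Polynomial ℝ := ∑ i : Fin n, Polynomial.C (v i) * Polynomial.X ^ (i : ℕ) with hp
  have hcoeff (i : Fin n) : p.coeff i = v i := by
    simp [hp, Polynomial.coeff_C_mul, Polynomial.coeff_X_pow,
      Fin.val_inj]
  have hpne : p ≠ 0 := by
    rintro h
    apply hv0
    ext i
    simp [← hcoeff, h]
  have hint (k : ℕ) : Integrable (fun x => x ^ k * W x) := by
    simpa using integrable_pow_mul_exp_mul hWmeas hWint k 0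
  have hexp : (fun x => p.eval x ^ 2 * W x) =
      fun x => ∑ i : Fin n, ∑ k : Fin n, v i * v k * (x ^ ((i : ℕ) + k) * W x) := by
    ext x
    have : p.eval x = ∑ i : Fin n, v i * x ^ (i : ℕ) := by simp [hp, Polynomial.eval_finsetSum]
    rw [this, sq, Finset.sum_mul_sum, Finset.sum_mul]
    refine Finset.sum_congr rfl fun i _ => ?_
    rw [Finset.sum_mul]
    exact Finset.sum_congr rfl fun k _ => by ring
  have hpint : Integrable (fun x => p.eval x ^ 2 * W x) := by
    rw [hexp]
    exact integrable_finsetSum _ fun i _ => integrable_finsetSum _ fun k _ =>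
      (hint _).const_mul _
  have hzero : ∫ x, p.eval x ^ 2 * W x = 0 := by
    rw [hexp, integral_finsetSum _ fun i _ => integrable_finsetSum _ fun k _ =>
      (hint _).const_mul _]
    refine Finset.sum_eq_zero fun i _ => ?_
    rw [integral_finsetSum _ fun k _ => (hint _).const_mul _]
    have := congrFun hv i
    simp only [Matrix.mulVec, dotProduct, Matrix.of_apply, expMoment, zero_mul, Real.exp_zero,
      mul_one, Pi.zero_apply] at this
    rw [← mul_zero (v i), ← this, Finset.mul_sum]
    refine Finset.sum_congr rfl fun k _ => ?_
    rw [integral_const_mul]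
    ring
  rw [integral_eq_zero_iff_of_nonneg (fun x => mul_nonneg (sq_nonneg _) (hWnonneg x)) hpint]
    at hzero
  apply hW
  have hroots : ∀ᵐ x : ℝ, x ∉ (p.roots.toFinset : Set ℝ) :=
    measure_eq_zero_iff_ae_notMem.mp (Finset.measure_zero _ _)
  filter_upwards [hzero, hroots] with x hx hr
  have : p.eval x ≠ 0 := by
    intro h
    apply hr
    simp [hpne, h]
  simpa [this] using hx

end Positivity

lemma Zpart_eq_det {W : ℝ → ℝ} (hWmeas : Measurable W)
    (hWint : ∀ (n : ℕ) (b : ℝ), Integrable (fun x => |x| ^ n * Real.exp (b * x) * W x))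
    (s m : ℕ) (a : ℕ → ℝ) :
    Zpart W (s + m) m a = ((∏ i ∈ Finset.range s, (Nat.factorial i : ℝ)) *
      (∏ p ∈ pairsBelow m, (a p.2 - a p.1)) * ∏ k ∈ Finset.range m, a k ^ s)⁻¹ *
      ((s + m).factorial *
        (Matrix.of fun i k : Fin (s + m) => Fin.addCases (fun i' : Fin s => expMoment W 0 (i' + k))
          (fun j : Fin m => expMoment W (a j) k) i).det) := by
  have hI := integrable_pow_mul_exp_mul hWmeas hWint
  have hφ (i k : Fin (s + m)) : (Integrable fun x : ℝ => (if (i : ℕ) < s then x ^ (i : ℕ)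
      else Real.exp (a ((i : ℕ) - s) * x)) * x ^ (k : ℕ) * W x) ∧
      ∫ x : ℝ, (if (i : ℕ) < s then x ^ (i : ℕ)
      else Real.exp (a ((i : ℕ) - s) * x)) * x ^ (k : ℕ) * W x =
      Fin.addCases (motive := fun _ => ℝ) (fun i' : Fin s => expMoment W 0 (i' + k))
          (fun j : Fin m => expMoment W (a j) k) i := by
    induction i using Fin.addCases with
    | left i =>
      have : (fun x : ℝ => (if ((Fin.castAdd m i : Fin (s + m)) : ℕ) < s then
          x ^ ((Fin.castAdd m i : Fin (s + m)) : ℕ)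
          else Real.exp (a (((Fin.castAdd m i : Fin (s + m)) : ℕ) - s) * x)) * x ^ (k : ℕ) * W x) =
          fun x => x ^ ((i : ℕ) + k) * Real.exp (0 * x) * W x := by
        ext x
        simp [pow_add]
      rw [this, Fin.addCases_left]
      exact ⟨hI _ _, rfl⟩
    | right j =>
      have : (fun x : ℝ => (if ((Fin.natAdd s j : Fin (s + m)) : ℕ) < s then
          x ^ ((Fin.natAdd s j : Fin (s + m)) : ℕ)
          else Real.exp (a (((Fin.natAdd s j : Fin (s + m)) : ℕ) - s) * x)) * x ^ (k : ℕ) * W x) =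
          fun x => x ^ (k : ℕ) * Real.exp (a j * x) * W x := by
        ext x
        simp [mul_comm]
      rw [this, Fin.addCases_right]
      exact ⟨hI _ _, rfl⟩
  rw [Zpart, Nat.add_sub_cancel]
  congr 1
  rw [integral_det_mul_vandermondeProd W (s + m) (fun i x => if (i : ℕ) < s then x ^ (i : ℕ)
      else Real.exp (a ((i : ℕ) - s) * x)) fun i k => (hφ i k).1]
  congr 3
  ext i k
  exact (hφ i k).2

lemma Zpart_zero_eq_zero_of_ae_eq_zero {W : ℝ → ℝ} (hW : W =ᵐ[volume] 0)
    (hWmeas : Measurable W)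
    (hWint : ∀ (n : ℕ) (b : ℝ), Integrable (fun x => |x| ^ n * Real.exp (b * x) * W x))
    {d : ℕ} (hd : d ≠ 0) (a : ℕ → ℝ) : Zpart W d 0 a = 0 := by
  have hmom (b : ℝ) (n : ℕ) : expMoment W b n = 0 := by
    refine integral_eq_zero_of_ae ?_
    filter_upwards [hW] with x hx
    simp [hx]
  have : Nonempty (Fin d) := ⟨⟨0, Nat.pos_of_ne_zero hd⟩⟩
  have h := Zpart_eq_det hWmeas hWint d 0 a
  simp only [hmom] at h
  have h0 : (Matrix.of fun i _ : Fin (d + 0) => Fin.addCases (motive := fun _ => ℝ)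
      (fun _ : Fin d => (0 : ℝ)) (fun _ : Fin 0 => 0) i) = 0 := by
    ext i k
    exact Fin.addCases (motive := fun i => Fin.addCases (motive := fun _ => ℝ)
      (fun _ : Fin d => (0 : ℝ)) (fun _ : Fin 0 => 0) i = 0)
      (fun i => Fin.addCases_left i) (fun j => j.elim0) i
  rw [h0, Matrix.det_zero] at h
  simpa using h

lemma Zpart_eq_rowPair {W : ℝ → ℝ} (hWmeas : Measurable W)
    (hWint : ∀ (n : ℕ) (b : ℝ), Integrable (fun x => |x| ^ n * Real.exp (b * x) * W x))
    {c : ℕ → ℕ → ℝ} (hc : ∀ k, c k k = 1)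
    (horth : ∀ k, ∀ i < k, rowPair c (fun l => expMoment W 0 (i + l)) k = 0)
    (s m : ℕ) (a : ℕ → ℝ) :
    Zpart W (s + m) m a = ((∏ i ∈ Finset.range s, (Nat.factorial i : ℝ)) *
      (∏ p ∈ pairsBelow m, (a p.2 - a p.1)) * ∏ k ∈ Finset.range m, a k ^ s)⁻¹ *
      ((s + m).factorial *
        ((∏ i ∈ Finset.range s, rowPair c (fun l => expMoment W 0 (i + l)) i) *
          (Matrix.of fun j k : Fin m => rowPair c (expMoment W (a j)) (s + k)).det)) := by
  rw [Zpart_eq_det hWmeas hWint, det_bordered s m (fun i l => expMoment W 0 (i + l)) c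
    (fun j => expMoment W (a j)) hc horth]

/-- Determinantal reduction of the rank-`m` partition function to rank-one partition
functions: `Z_d(a_1,…,a_m)/Z_d = [∏_{j<k}(a_j−a_k)]⁻¹ det[a_k^{m−j} Z_{d+1−j}(a_k)/Z_{d+1−j}]`. -/
theorem Zpart_ratio_eq_det_rank_one
    (W : ℝ → ℝ) (hWmeas : Measurable W) (hWnonneg : ∀ x, 0 ≤ W x)
    (hWsupp : (Function.support W).Infinite)
    (hWint : ∀ (n : ℕ) (b : ℝ), Integrable (fun x => |x| ^ n * Real.exp (b * x) * W x))
    (m d : ℕ) (hm : 1 ≤ m) (hmd : m ≤ d)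
    (a : ℕ → ℝ)
    (hane : ∀ i < m, a i ≠ 0)
    (hadist : ∀ i < m, ∀ j < m, i ≠ j → a i ≠ a j) :
    Zpart W d m a / Zpart W d 0 a =
      (∏ p ∈ pairsBelow m, (a p.1 - a p.2))⁻¹ *
        (Matrix.of fun j k : Fin m =>
            a (k : ℕ) ^ (m - 1 - (j : ℕ)) *
              (Zpart W (d - (j : ℕ)) 1 (fun _ => a (k : ℕ)) /
                Zpart W (d - (j : ℕ)) 0 a)).det := by
  by_cases hW : W =ᵐ[volume] 0
  · have hZ (j : Fin m) : Zpart W (d - j) 0 a = 0 :=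
      Zpart_zero_eq_zero_of_ae_eq_zero hW hWmeas hWint (by omega) a
    have hZd : Zpart W d 0 a = 0 :=
      Zpart_zero_eq_zero_of_ae_eq_zero hW hWmeas hWint (by omega) a
    have hne : Nonempty (Fin m) := ⟨⟨0, hm⟩⟩
    have h0 : (Matrix.of fun j k : Fin m => a (k : ℕ) ^ (m - 1 - (j : ℕ)) *
        (Zpart W (d - (j : ℕ)) 1 (fun _ => a (k : ℕ)) / Zpart W (d - (j : ℕ)) 0 a)) = 0 := by
      ext j k
      simp [hZ]
    rw [h0, Matrix.det_zero, hZd]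
    simp
  obtain ⟨s, rfl⟩ : ∃ s, d = s + m := ⟨d - m, by omega⟩
  have hH := det_hankel_ne_zero hWmeas hWnonneg hWint hW
  obtain ⟨c, hc, horth⟩ := exists_orthogonal_coeffs (fun i l => expMoment W 0 (i + l)) hH
  have hZ := Zpart_eq_rowPair hWmeas hWint hc horth
  set h : ℕ → ℝ := fun i => rowPair c (fun l => expMoment W 0 (i + l)) i with hh
  have hZ0 (n : ℕ) : Zpart W n 0 a =
      (∏ i ∈ Finset.range n, (Nat.factorial i : ℝ))⁻¹ *
        (n.factorial * ∏ i ∈ Finset.range n, h i) := by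
    simpa [pairsBelow] using hZ n 0 a
  have hpairs : pairsBelow 1 = ∅ := rfl
  have hZ1 (n : ℕ) (b : ℝ) : Zpart W (n + 1) 1 (fun _ => b) =
      ((∏ i ∈ Finset.range n, (Nat.factorial i : ℝ)) * b ^ n)⁻¹ *
        ((n + 1).factorial * ((∏ i ∈ Finset.range n, h i) * rowPair c (expMoment W b) n)) := by
    simpa [hpairs] using hZ n 1 (fun _ => b)
  have hprod (n : ℕ) : ∏ i ∈ Finset.range n, h i ≠ 0 := by
    have := det_bordered n 0 (fun i l => expMoment W 0 (i + l)) c (fun _ _ => 0) hc horth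
    rw [Matrix.det_isEmpty (A := Matrix.of fun j k : Fin 0 => _), mul_one] at this
    have hblock : (Matrix.of fun i k : Fin (n + 0) => Fin.addCases (motive := fun _ => ℝ)
        (fun i' : Fin n => expMoment W 0 (i' + k)) (fun _ : Fin 0 => 0) i) =
        (Matrix.of fun i k : Fin (n + 0) => expMoment W 0 (i + k)) := by
      ext i k
      exact Fin.addCases_left (m := n) (n := 0) (motive := fun _ => ℝ)
        (left := fun i' : Fin n => expMoment W 0 (i' + k)) (right := fun _ => 0) i
    rw [hh, ← this, hblock]
    exact hH n
  have hhne (n : ℕ) : h n ≠ 0 := by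
    have := hprod (n + 1)
    rw [Finset.prod_range_succ] at this
    exact right_ne_zero_of_mul this
  have hfac (n : ℕ) : ∏ i ∈ Finset.range n, (Nat.factorial i : ℝ) ≠ 0 :=
    Finset.prod_ne_zero_iff.mpr fun i _ => by positivity
  have hratio (n : ℕ) (b : ℝ) : Zpart W (n + 1) 1 (fun _ => b) / Zpart W (n + 1) 0 a =
      (n.factorial / h n) * ((b ^ n)⁻¹ * rowPair c (expMoment W b) n) := by
    rw [hZ1, hZ0, Finset.prod_range_succ, Finset.prod_range_succ, mul_inv]
    have h1 := hfac n
    have h2 := hprod n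
    have h3 := hhne n
    have h4 : (n.factorial : ℝ) ≠ 0 := by positivity
    have h5 : ((n + 1).factorial : ℝ) ≠ 0 := by positivity
    generalize (b ^ n)⁻¹ = y
    field_simp
  set N : Matrix (Fin m) (Fin m) ℝ :=
    Matrix.of fun k j => rowPair c (expMoment W (a j)) (s + k) with hN
  have hmat : (Matrix.of fun j k : Fin m => a (k : ℕ) ^ (m - 1 - (j : ℕ)) *
        (Zpart W (s + m - (j : ℕ)) 1 (fun _ => a (k : ℕ)) / Zpart W (s + m - (j : ℕ)) 0 a)) =
      Matrix.of fun j k : Fin m => ((s + (Fin.revPerm j : Fin m)).factorial /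
        h (s + (Fin.revPerm j : Fin m))) *
        (Matrix.of fun j k : Fin m => (a k ^ s)⁻¹ * N.submatrix Fin.revPerm id j k) j k := by
    ext j k
    have e1 : s + m - (j : ℕ) = (s + (Fin.revPerm j : Fin m)) + 1 := by
      simp only [Fin.revPerm_apply, Fin.val_rev]; omega
    have e2 : m - 1 - (j : ℕ) = (Fin.revPerm j : Fin m) := by
      simp only [Fin.revPerm_apply, Fin.val_rev]; omega
    have hak := hane k k.isLt
    simp only [Matrix.of_apply, Matrix.submatrix_apply, id, e1, e2, hratio, hN]
    rw [pow_add, mul_inv]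
    have := pow_ne_zero (Fin.revPerm j : Fin m) hak
    field_simp
  rw [hmat, Matrix.det_mul_column, Matrix.det_mul_row, mul_left_comm, mul_left_comm _ (∏ k, _),
    inv_prod_pairsBelow_mul_det, Equiv.prod_comp Fin.revPerm
      (fun j : Fin m => ((s + (j : ℕ)).factorial : ℝ) / h (s + j)), hZ, hZ0,
    Finset.prod_range_add, Finset.prod_range_add, ← Matrix.det_transpose N,
    Finset.prod_div_distrib, Finset.prod_inv_distrib,
    ← Finset.prod_range (fun i => ((s + i).factorial : ℝ)),
    ← Finset.prod_range (fun i => h (s + i)), ← Finset.prod_range (fun i => a i ^ s)]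
  have hNT : (Matrix.of fun j k : Fin m => rowPair c (expMoment W (a j)) (s + k)) =
      N.transpose := rfl
  rw [hNT, mul_inv, mul_inv]
  have h1 := hfac s
  have h2 := hprod s
  have h3 : ((s + m).factorial : ℝ) ≠ 0 := by positivity
  generalize (∏ p ∈ pairsBelow m, (a p.2 - a p.1))⁻¹ = x
  generalize (∏ k ∈ Finset.range m, a k ^ s)⁻¹ = y
  field_simp
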